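/- arXiv:1404.5214 — 3 statements merged into one kernel-verified Lean document; each statement's English description precedes it below -/
import Mathlib

section
/- Let A ∈ ℝ^{n×n} and let P ∈ ℝ^{n×n} be a permutation matrix. Assume that ‖x_A⁽ᵗ⁾‖₁ ≠ 0 for all 0 ≤ t < k. Then for every 0 ≤ t ≤ k, x_{PAPᵀ}⁽ᵗ⁾ = P · x_A⁽ᵗ⁾; equivalently, the power summary satisfies S^{PAPᵀ} = P · S^A (the rows of S^A are shuffled by π). -/
open Matrix MeasureTheory Real BigOperators

/-- The permutation matrix of `σ`: `(P v) (σ i) = v i`. -/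
noncomputable def permMatrix {n : ℕ} (σ : Equiv.Perm (Fin n)) : Matrix (Fin n) (Fin n) ℝ :=
  Matrix.of fun i j => if i = σ j then 1 else 0

/-- ℓ1 norm of a vector. -/
noncomputable def l1norm {n : ℕ} (v : Fin n → ℝ) : ℝ := ∑ i, |v i|

/-- Power iteration started at the all-ones vector. -/
noncomputable def powerIter {n : ℕ} (A : Matrix (Fin n) (Fin n) ℝ) : ℕ → (Fin n → ℝ)
  | 0 => fun _ => 1
  | t + 1 => A.mulVec ((l1norm (powerIter A t))⁻¹ • powerIter A t)

/-- Power summary `S^A ∈ ℝ^{n×k}`, whose `t`-th column is `x_A^{(t+1)}`. -/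
noncomputable def powSummary {n : ℕ} (k : ℕ) (A : Matrix (Fin n) (Fin n) ℝ) :
    Matrix (Fin n) (Fin k) ℝ :=
  Matrix.of fun i t => powerIter A (t + 1) i

theorem permMatrix_mulVec_apply {n : ℕ} (σ : Equiv.Perm (Fin n)) (v : Fin n → ℝ) (i : Fin n) :
    (permMatrix σ *ᵥ v) i = v (σ.symm i) := by
  simp [permMatrix, Matrix.mulVec, dotProduct, ← Equiv.symm_apply_eq]

theorem permMatrix_transpose_mul_self {n : ℕ} (σ : Equiv.Perm (Fin n)) :
    (permMatrix σ)ᵀ * permMatrix σ = 1 := by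
  ext i j
  simp [permMatrix, Matrix.mul_apply, Matrix.one_apply, eq_comm]

theorem l1norm_permMatrix_mulVec {n : ℕ} (σ : Equiv.Perm (Fin n)) (v : Fin n → ℝ) :
    l1norm (permMatrix σ *ᵥ v) = l1norm v := by
  simp only [l1norm, permMatrix_mulVec_apply]
  exact Equiv.sum_comp σ.symm fun i => |v i|

theorem powerIter_permMatrix_conj {n : ℕ} (A : Matrix (Fin n) (Fin n) ℝ)
    (σ : Equiv.Perm (Fin n)) (t : ℕ) :
    powerIter (permMatrix σ * A * (permMatrix σ)ᵀ) t = permMatrix σ *ᵥ powerIter A t := by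
  induction t with
  | zero =>
    ext i
    rw [permMatrix_mulVec_apply]
    rfl
  | succ t ih =>
    simp only [powerIter]
    rw [ih, l1norm_permMatrix_mulVec, ← Matrix.mulVec_smul, Matrix.mulVec_mulVec,
      Matrix.mul_assoc, permMatrix_transpose_mul_self, Matrix.mul_one, Matrix.mulVec_mulVec]

/-- Theorem 1 (first part): the normalized power iteration is permutation-equivariant,
and hence the power summary satisfies `S^{PAPᵀ} = P * S^A`. -/
theorem powerIter_perm_equivariant {n k : ℕ} (A : Matrix (Fin n) (Fin n) ℝ)
    (σ : Equiv.Perm (Fin n))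
    (hl1 : ∀ t < k, l1norm (powerIter A t) ≠ 0) :
    (∀ t ≤ k, powerIter (permMatrix σ * A * (permMatrix σ)ᵀ) t
        = permMatrix σ *ᵥ powerIter A t) ∧
      powSummary k (permMatrix σ * A * (permMatrix σ)ᵀ) = permMatrix σ * powSummary k A := by
  refine ⟨fun t _ => powerIter_permMatrix_conj A σ t, ?_⟩
  ext i t
  exact congrFun (powerIter_permMatrix_conj A σ (t + 1)) i
end

section
/- Let A ∈ ℝ^{n×n} and let P ∈ ℝ^{n×n} be a permutation matrix. Assume that ‖x_A⁽ᵗ⁾‖₁ ≠ 0 for all 0 ≤ t < k. Then the mean vectors of the rows of the power summaries coincide: μ^{PAPᵀ} = μ^A. -/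
open Matrix MeasureTheory Real BigOperators

/-- Mean vector of the rows of the power summary. -/
noncomputable def meanVec {n : ℕ} (k : ℕ) (A : Matrix (Fin n) (Fin n) ℝ) : Fin k → ℝ :=
  (n : ℝ)⁻¹ • ∑ i, powSummary k A i

lemma permMatrix_conj {n : ℕ} (A : Matrix (Fin n) (Fin n) ℝ) (σ : Equiv.Perm (Fin n)) :
    permMatrix σ * A * (permMatrix σ)ᵀ = A.submatrix σ.symm σ.symm := by
  ext i j
  simp [permMatrix, Matrix.mul_apply, ← Equiv.symm_apply_eq]

lemma l1norm_comp_perm {n : ℕ} (v : Fin n → ℝ) (σ : Equiv.Perm (Fin n)) :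
    l1norm (v ∘ σ) = l1norm v :=
  Equiv.sum_comp σ fun i => |v i|

lemma powerIter_submatrix {n : ℕ} (A : Matrix (Fin n) (Fin n) ℝ) (σ : Equiv.Perm (Fin n))
    (t : ℕ) : powerIter (A.submatrix σ σ) t = powerIter A t ∘ σ := by
  induction t with
  | zero => rfl
  | succ t ih =>
    simp only [powerIter]
    rw [ih, l1norm_comp_perm, Matrix.submatrix_mulVec_equiv]
    congr 2
    ext i
    simp

lemma powSummary_submatrix {n : ℕ} (k : ℕ) (A : Matrix (Fin n) (Fin n) ℝ)
    (σ : Equiv.Perm (Fin n)) (i : Fin n) :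
    powSummary k (A.submatrix σ σ) i = powSummary k A (σ i) := by
  funext t
  exact congrFun (powerIter_submatrix A σ (t + 1)) i

/-- Part of Theorem 2: the mean vector of the rows of the power summary is a graph invariant. -/
theorem meanVec_perm_invariant {n k : ℕ} (A : Matrix (Fin n) (Fin n) ℝ)
    (σ : Equiv.Perm (Fin n))
    (hl1 : ∀ t < k, l1norm (powerIter A t) ≠ 0) :
    meanVec k (permMatrix σ * A * (permMatrix σ)ᵀ) = meanVec k A := by
  rw [permMatrix_conj]
  simp only [meanVec, powSummary_submatrix]
  rw [Equiv.sum_comp σ.symm (powSummary k A)]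
end

section
/- Let μ_A, μ_B ∈ ℝᵏ and let Σ_A, Σ_B ∈ ℝ^{k×k} be symmetric positive-definite matrices. Let Λ = (½ Σ_A⁻¹ + ½ Σ_B⁻¹)⁻¹ and η = ½ Σ_A⁻¹ μ_A + ½ Σ_B⁻¹ μ_B. Then the Bhattacharyya coefficient between the Gaussian densities p_A = N(μ_A, Σ_A) and p_B = N(μ_B, Σ_B) has the closed form ∫_{ℝᵏ} √(p_A(x)) √(p_B(x)) dx = (det Σ_A)^{−1/4} (det Σ_B)^{−1/4} (det Λ)^{1/2} · exp(−¼ μ_Aᵀ Σ_A⁻¹ μ_A − ¼ μ_Bᵀ Σ_B⁻¹ μ_B + ½ ηᵀ Λ η). -/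
open Matrix MeasureTheory Real BigOperators

/-- The Gaussian density with mean `μ` and covariance `S`. -/
noncomputable def gaussDensity {k : ℕ} (μ : Fin k → ℝ) (S : Matrix (Fin k) (Fin k) ℝ)
    (x : Fin k → ℝ) : ℝ :=
  (Real.sqrt ((2 * Real.pi) ^ k * S.det))⁻¹ *
    Real.exp (-(dotProduct (x - μ) (S⁻¹ *ᵥ (x - μ))) / 2)

/-- Expansion of a symmetric quadratic form at a difference of vectors. -/
lemma dotProduct_mulVec_sub_self {n : Type*} [Fintype n] {A : Matrix n n ℝ} (hA : A.IsSymm)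
    (x a : n → ℝ) :
    dotProduct (x - a) (A *ᵥ (x - a)) =
      dotProduct x (A *ᵥ x) - 2 * dotProduct x (A *ᵥ a) + dotProduct a (A *ᵥ a) := by
  have h : dotProduct a (A *ᵥ x) = dotProduct x (A *ᵥ a) := by
    rw [dotProduct_mulVec, ← mulVec_transpose, hA.eq, dotProduct_comm]
  rw [mulVec_sub, sub_dotProduct, dotProduct_sub, dotProduct_sub, h]
  ring

lemma integral_exp_neg_dotProduct_self_div_two (n : Type*) [Fintype n] :
    ∫ x : n → ℝ, Real.exp (-(dotProduct x x) / 2) = √(2 * π) ^ Fintype.card n := by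
  have h (x : n → ℝ) :
      Real.exp (-(dotProduct x x) / 2) = ∏ i, Real.exp (-(1 / 2) * x i ^ 2) := by
    rw [← Real.exp_sum, ← Finset.mul_sum]
    simp only [dotProduct, pow_two]
    ring_nf
  simp_rw [h]
  rw [integral_fintype_prod_volume_eq_pow (fun t : ℝ ↦ Real.exp (-(1 / 2) * t ^ 2)),
    integral_gaussian]
  congr 2
  ring

open scoped MatrixOrder in
/-- The Gaussian integral for a positive-definite quadratic form. -/
lemma Matrix.PosDef.integral_exp_neg_dotProduct_mulVec_div_two {n : Type*} [Fintype n]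
    [DecidableEq n] {P : Matrix n n ℝ} (hP : P.PosDef) :
    ∫ x : n → ℝ, Real.exp (-(dotProduct x (P *ᵥ x)) / 2) =
      √((2 * π) ^ Fintype.card n * P⁻¹.det) := by
  obtain ⟨B, hB, rfl⟩ :=
    CStarAlgebra.isStrictlyPositive_iff_eq_star_mul_self.mp hP.isStrictlyPositive
  have hdet : B.det ≠ 0 := ((Matrix.isUnit_iff_isUnit_det B).mp hB).ne_zero
  have hquad (x : n → ℝ) :
      dotProduct x ((star B * B) *ᵥ x) = dotProduct (B *ᵥ x) (B *ᵥ x) := by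
    rw [← mulVec_mulVec, star_eq_conjTranspose, conjTranspose_eq_transpose_of_trivial,
      dotProduct_mulVec, vecMul_transpose]
  have hmap := Real.map_matrix_volume_pi_eq_smul_volume_pi hdet
  have hint : ∫ x : n → ℝ, Real.exp (-(dotProduct (B *ᵥ x) (B *ᵥ x)) / 2) =
      |B.det⁻¹| * √(2 * π) ^ Fintype.card n := by
    have hcont : Continuous fun x : n → ℝ ↦ Real.exp (-(dotProduct x x) / 2) := by
      unfold dotProduct
      fun_prop
    have := integral_map (μ := volume) (φ := toLin' B)
      (LinearMap.continuous_of_finiteDimensional _).measurable.aemeasurable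
      hcont.aestronglyMeasurable
    rw [hmap, integral_smul_measure, integral_exp_neg_dotProduct_self_div_two,
      ENNReal.toReal_ofReal (abs_nonneg _), smul_eq_mul] at this
    simpa only [toLin'_apply] using this.symm
  simp_rw [hquad]
  rw [hint, det_nonsing_inv, Ring.inverse_eq_inv', det_mul, star_eq_conjTranspose,
    conjTranspose_eq_transpose_of_trivial, det_transpose, mul_inv, ← pow_two,
    Real.sqrt_mul (x := (2 * π) ^ Fintype.card n) (by positivity), Real.sqrt_sq_eq_abs, mul_comm]
  congr 1
  rw [eq_comm, Real.sqrt_eq_iff_mul_self_eq (by positivity) (by positivity), ← mul_pow,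
    Real.mul_self_sqrt (by positivity)]

lemma sqrt_gaussDensity {k : ℕ} (μ : Fin k → ℝ) (S : Matrix (Fin k) (Fin k) ℝ) (hS : 0 < S.det)
    (x : Fin k → ℝ) :
    √(gaussDensity μ S x) = ((2 * π) ^ k) ^ (-(1 / 4 : ℝ)) * S.det ^ (-(1 / 4 : ℝ)) *
      Real.exp (-(dotProduct (x - μ) (S⁻¹ *ᵥ (x - μ))) / 4) := by
  have hc : 0 < (2 * π) ^ k := by positivity
  rw [gaussDensity, Real.sqrt_mul (by positivity), Real.sqrt_inv, ← Real.exp_half,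
    ← Real.mul_rpow hc.le hS.le, Real.sqrt_eq_rpow, Real.sqrt_eq_rpow,
    ← Real.rpow_mul (by positivity), ← Real.rpow_neg (by positivity)]
  ring_nf

/-- Closed form (Eq. (5) of the paper) of the Bhattacharyya coefficient between two
Gaussian densities `N(μA, SA)` and `N(μB, SB)`, where `Λ = (½SA⁻¹ + ½SB⁻¹)⁻¹` and
`η = ½SA⁻¹μA + ½SB⁻¹μB`. -/
theorem bhattacharyya_gaussian_closed_form {k : ℕ} (μA μB : Fin k → ℝ)
    (SA SB : Matrix (Fin k) (Fin k) ℝ) (hA : SA.PosDef) (hB : SB.PosDef) :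
    (∫ x : Fin k → ℝ, Real.sqrt (gaussDensity μA SA x) * Real.sqrt (gaussDensity μB SB x)) =
      SA.det ^ (-(1 / 4 : ℝ)) * SB.det ^ (-(1 / 4 : ℝ)) *
        (((2 : ℝ)⁻¹ • SA⁻¹ + (2 : ℝ)⁻¹ • SB⁻¹)⁻¹).det ^ ((1 / 2 : ℝ)) *
        Real.exp
          (-(dotProduct μA (SA⁻¹ *ᵥ μA)) / 4 - dotProduct μB (SB⁻¹ *ᵥ μB) / 4 +
            dotProduct ((2 : ℝ)⁻¹ • (SA⁻¹ *ᵥ μA) + (2 : ℝ)⁻¹ • (SB⁻¹ *ᵥ μB))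
              (((2 : ℝ)⁻¹ • SA⁻¹ + (2 : ℝ)⁻¹ • SB⁻¹)⁻¹ *ᵥ
                ((2 : ℝ)⁻¹ • (SA⁻¹ *ᵥ μA) + (2 : ℝ)⁻¹ • (SB⁻¹ *ᵥ μB))) / 2) := by
  set P : Matrix (Fin k) (Fin k) ℝ := (2 : ℝ)⁻¹ • SA⁻¹ + (2 : ℝ)⁻¹ • SB⁻¹ with hPdef
  set η : Fin k → ℝ := (2 : ℝ)⁻¹ • (SA⁻¹ *ᵥ μA) + (2 : ℝ)⁻¹ • (SB⁻¹ *ᵥ μB) with hη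
  have hP : P.PosDef := (hA.inv.smul (by norm_num)).add (hB.inv.smul (by norm_num))
  have symm {M : Matrix (Fin k) (Fin k) ℝ} (hM : M.PosDef) : M.IsSymm := by
    simpa [IsHermitian, IsSymm] using hM.isHermitian
  have hPη : P *ᵥ (P⁻¹ *ᵥ η) = η := by
    rw [mulVec_mulVec, mul_nonsing_inv _ hP.det_pos.ne'.isUnit, one_mulVec]
  have hquad (x : Fin k → ℝ) :
      -(dotProduct (x - μA) (SA⁻¹ *ᵥ (x - μA))) / 4 +
          -(dotProduct (x - μB) (SB⁻¹ *ᵥ (x - μB))) / 4 =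
        -(dotProduct (x - P⁻¹ *ᵥ η) (P *ᵥ (x - P⁻¹ *ᵥ η))) / 2 +
          (-(dotProduct μA (SA⁻¹ *ᵥ μA)) / 4 - dotProduct μB (SB⁻¹ *ᵥ μB) / 4 +
            dotProduct η (P⁻¹ *ᵥ η) / 2) := by
    have hxP : dotProduct x (P *ᵥ x) =
        2⁻¹ * dotProduct x (SA⁻¹ *ᵥ x) + 2⁻¹ * dotProduct x (SB⁻¹ *ᵥ x) := by
      simp [hPdef, add_mulVec, smul_mulVec, dotProduct_add]
    have hxη : dotProduct x η =
        2⁻¹ * dotProduct x (SA⁻¹ *ᵥ μA) + 2⁻¹ * dotProduct x (SB⁻¹ *ᵥ μB) := by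
      simp [hη, dotProduct_add]
    rw [dotProduct_mulVec_sub_self (symm hA.inv), dotProduct_mulVec_sub_self (symm hB.inv),
      dotProduct_mulVec_sub_self (symm hP), hPη, dotProduct_comm (P⁻¹ *ᵥ η) η, hxP, hxη]
    ring
  set c := -(dotProduct μA (SA⁻¹ *ᵥ μA)) / 4 - dotProduct μB (SB⁻¹ *ᵥ μB) / 4 +
    dotProduct η (P⁻¹ *ᵥ η) / 2
  have hpi : 0 < (2 * π) ^ k := by positivity
  have hprod (x : Fin k → ℝ) : √(gaussDensity μA SA x) * √(gaussDensity μB SB x) =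
      ((2 * π) ^ k) ^ (-(1 / 2 : ℝ)) * SA.det ^ (-(1 / 4 : ℝ)) * SB.det ^ (-(1 / 4 : ℝ)) *
        Real.exp c * Real.exp (-(dotProduct (x - P⁻¹ *ᵥ η) (P *ᵥ (x - P⁻¹ *ᵥ η))) / 2) := by
    have hexp := congrArg Real.exp (hquad x)
    rw [Real.exp_add, Real.exp_add] at hexp
    have hpow : ((2 * π) ^ k) ^ (-(1 / 2 : ℝ)) =
        ((2 * π) ^ k) ^ (-(1 / 4 : ℝ)) * ((2 * π) ^ k) ^ (-(1 / 4 : ℝ)) := by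
      rw [← Real.rpow_add hpi]
      norm_num
    rw [sqrt_gaussDensity μA SA hA.det_pos, sqrt_gaussDensity μB SB hB.det_pos, hpow]
    linear_combination ((2 * π) ^ k) ^ (-(1 / 4 : ℝ)) * ((2 * π) ^ k) ^ (-(1 / 4 : ℝ)) *
      SA.det ^ (-(1 / 4 : ℝ)) * SB.det ^ (-(1 / 4 : ℝ)) * hexp
  simp_rw [hprod]
  rw [integral_const_mul,
    integral_sub_right_eq_self (fun x ↦ Real.exp (-(dotProduct x (P *ᵥ x)) / 2)) (P⁻¹ *ᵥ η),
    hP.integral_exp_neg_dotProduct_mulVec_div_two, Fintype.card_fin, Real.sqrt_eq_rpow,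
    Real.mul_rpow hpi.le hP.inv.det_pos.le]
  have hcancel : ((2 * π) ^ k) ^ (-(1 / 2 : ℝ)) * ((2 * π) ^ k) ^ (1 / 2 : ℝ) = 1 := by
    rw [← Real.rpow_add hpi]
    norm_num
  linear_combination SA.det ^ (-(1 / 4 : ℝ)) * SB.det ^ (-(1 / 4 : ℝ)) *
    P⁻¹.det ^ (1 / 2 : ℝ) * Real.exp c * hcancel
end
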